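/- arXiv:0804.3645 — 2 statements merged into one kernel-verified Lean document; each statement's English description precedes it below -/
import Mathlib

section
/- Let p, q : ℕ → ℝ be sequences with p(0) < q(0), p(1) > 0, and q(1) > 0. Then there exists a surjective C^∞ function g : ℝ → ℝ with g'(x) > 0 for all x ∈ ℝ such that g^(n)(0) = p(n) and g^(n)(1) = q(n) for every n ∈ ℕ. Consequently, the jet map g ↦ ((g^(n)(0))_{n∈ℕ}, (g^(n)(1))_{n∈ℕ}) maps the set of orientation-preserving C^∞ diffeomorphisms of ℝ onto the set of pairs of sequences (p, q) with p(0) < q(0), p(1) > 0 and q(1) > 0. -/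
theorem borel_jet (a : ℕ → ℝ) : ∃ f : ℝ → ℝ, ContDiff ℝ (⊤ : ℕ∞) f ∧
    ∀ n, iteratedDeriv n f 0 = a n := by
  let χ : ContDiffBump (0 : ℝ) := ⟨1, 2, by norm_num, by norm_num⟩
  let h : ℕ → ℝ → ℝ := fun i y => y ^ i * χ y
  have hs : ∀ i, ContDiff ℝ (⊤ : ℕ∞) (h i) := fun i => (contDiff_id.pow i).mul χ.contDiff
  have hc : ∀ i, HasCompactSupport (h i) := fun i => χ.hasCompactSupport.mul_left
  have hb : ∀ k i, ∃ C, ∀ x, ‖iteratedDeriv k (h i) x‖ ≤ C := by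
    intro k i
    obtain ⟨C, hC⟩ := ((hc i).iteratedFDeriv (𝕜 := ℝ) k).exists_bound_of_continuous
      ((hs i).continuous_iteratedFDeriv (by exact_mod_cast le_top))
    refine ⟨C, fun x => ?_⟩
    rw [← norm_iteratedFDeriv_eq_norm_iteratedDeriv]
    exact hC x
  choose C hC using hb
  have hC0 : ∀ k i, 0 ≤ C k i := fun k i => (norm_nonneg _).trans (hC k i 0)
  let b : ℕ → ℝ := fun i => a i / (i.factorial : ℝ)
  let l : ℕ → ℝ := fun i => 1 + |b i| * 2 ^ i * ∑ k ∈ Finset.range i, C k i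
  have hS : ∀ i, 0 ≤ ∑ k ∈ Finset.range i, C k i := fun i =>
    Finset.sum_nonneg fun k _ => hC0 k i
  have hl1 : ∀ i, 1 ≤ l i := by
    intro i
    have := mul_nonneg (mul_nonneg (abs_nonneg (b i)) (by positivity : (0:ℝ) ≤ 2 ^ i)) (hS i)
    simp only [l]; linarith
  have hl0 : ∀ i, 0 < l i := fun i => lt_of_lt_of_le one_pos (hl1 i)
  have hlC : ∀ k i, k < i → |b i| * 2 ^ i * C k i ≤ l i := by
    intro k i hk
    have h1 : C k i ≤ ∑ k ∈ Finset.range i, C k i :=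
      Finset.single_le_sum (f := fun k => C k i) (fun k _ => hC0 k i) (Finset.mem_range.2 hk)
    have := mul_le_mul_of_nonneg_left h1
      (mul_nonneg (abs_nonneg (b i)) (by positivity : (0:ℝ) ≤ 2 ^ i))
    simp only [l]; linarith
  let f : ℕ → ℝ → ℝ := fun i x => (b i * ((l i)⁻¹) ^ i) * h i (l i * x)
  have hfs : ∀ i, ContDiff ℝ (⊤ : ℕ∞) (f i) := fun i =>
    contDiff_const.mul ((hs i).comp (contDiff_const.mul contDiff_id))
  have hfd : ∀ k i x, iteratedDeriv k (f i) x =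
      (b i * ((l i)⁻¹) ^ i) * ((l i) ^ k * iteratedDeriv k (h i) (l i * x)) := by
    intro k i x
    simp only [f]
    rw [iteratedDeriv_const_mul_field, iteratedDeriv_comp_const_mul
      ((hs i).of_le (by exact_mod_cast le_top))]
  let v : ℕ → ℕ → ℝ := fun k i => (|b i| * ((l i)⁻¹) ^ i) * ((l i) ^ k * C k i)
  have hv : ∀ k, Summable (v k) := by
    intro k
    refine Summable.of_norm_bounded_eventually_nat (g := fun i => (1/2 : ℝ) ^ i)
      summable_geometric_two ?_
    filter_upwards [Filter.eventually_gt_atTop k] with i hi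
    have hl := hl0 i
    have e0 : 0 ≤ v k i := by
      have := hC0 k i
      positivity
    rw [Real.norm_of_nonneg e0]
    obtain ⟨d, rfl⟩ := Nat.exists_eq_add_of_lt hi
    set i := k + d + 1 with hi'
    have e1 : ((l i)⁻¹) ^ i * (l i) ^ k ≤ (l i)⁻¹ := by
      have : ((l i)⁻¹) ^ i * (l i) ^ k = ((l i)⁻¹) ^ (d + 1) := by
        have : i = (d + 1) + k := by omega
        rw [this, pow_add, mul_assoc, ← mul_pow, ← this, inv_mul_cancel₀ hl.ne', one_pow, mul_one]
      rw [this]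
      exact pow_le_of_le_one (inv_nonneg.2 hl.le) (inv_le_one_of_one_le₀ (hl1 i)) (by omega)
    have e2 : v k i ≤ (|b i| * C k i) * (l i)⁻¹ := by
      have := mul_le_mul_of_nonneg_left e1 (mul_nonneg (abs_nonneg (b i)) (hC0 k i))
      calc v k i = (|b i| * C k i) * (((l i)⁻¹) ^ i * (l i) ^ k) := by simp only [v]; ring
        _ ≤ _ := this
    refine e2.trans ?_
    rw [← div_eq_mul_inv, div_le_iff₀ hl, one_div, inv_pow, inv_mul_eq_div,
      le_div_iff₀ (by positivity)]
    have := hlC k i hi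
    linarith
  have hfv : ∀ (k i : ℕ) (x : ℝ), (k : ℕ∞) ≤ ⊤ → ‖iteratedFDeriv ℝ k (f i) x‖ ≤ v k i := by
    intro k i x _
    have hl := hl0 i
    rw [norm_iteratedFDeriv_eq_norm_iteratedDeriv, hfd, norm_mul, norm_mul, norm_mul,
      Real.norm_eq_abs (b i), Real.norm_of_nonneg (by positivity : 0 ≤ (l i)⁻¹ ^ i),
      Real.norm_of_nonneg (by positivity : 0 ≤ (l i) ^ k)]
    have := hC k i (l i * x)
    simp only [v]
    gcongr
  refine ⟨fun x => ∑' i, f i x, contDiff_tsum hfs (fun k _ => hv k) hfv, fun n => ?_⟩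
  rw [iteratedDeriv_eq_iteratedFDeriv,
    iteratedFDeriv_tsum_apply hfs (fun k _ => hv k) hfv (by exact le_top)]
  have hsum : Summable fun i => iteratedFDeriv ℝ n (f i) 0 :=
    Summable.of_norm_bounded (hv n) fun i => hfv n i 0 le_top
  rw [ContinuousMultilinearMap.tsum_eval hsum]
  have hz : ∀ i, iteratedDeriv n (f i) 0 = if i = n then a n else 0 := by
    intro i
    have hev : h i =ᶠ[nhds 0] fun y => y ^ i := by
      filter_upwards [χ.eventuallyEq_one] with y hy
      simp [h, hy]
    rw [hfd, mul_zero, hev.iteratedDeriv_eq, iteratedDeriv_fun_pow_zero]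
    by_cases hin : i = n
    · subst hin
      have hl := (hl0 i).ne'
      have : (i.factorial : ℝ) ≠ 0 := by positivity
      simp only [if_true, b]
      have hp : (l i)⁻¹ ^ i * l i ^ i = 1 := by
        rw [← mul_pow, inv_mul_cancel₀ hl, one_pow]
      calc _ = a i / (i.factorial : ℝ) * (i.factorial : ℝ) * ((l i)⁻¹ ^ i * l i ^ i) := by ring
        _ = a i := by rw [hp, mul_one, div_mul_cancel₀ _ this]
    · simp [hin, Ne.symm hin]
  simp only [← iteratedDeriv_eq_iteratedFDeriv, hz, tsum_ite_eq]

theorem jet_exists (p q : ℕ → ℝ) (h0 : p 0 < q 0) (hp1 : 0 < p 1) (hq1 : 0 < q 1) :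
    ∃ g : ℝ → ℝ, ContDiff ℝ (⊤ : ℕ∞) g ∧ Function.Surjective g ∧
        (∀ x : ℝ, 0 < deriv g x) ∧
        (∀ n : ℕ, iteratedDeriv n g 0 = p n) ∧
        (∀ n : ℕ, iteratedDeriv n g 1 = q n) := by
  obtain ⟨F, hFs, hF⟩ := borel_jet fun n => p (n + 1)
  obtain ⟨G', hGs', hG'⟩ := borel_jet fun n => q (n + 1)
  obtain ⟨G, hGs, hG⟩ : ∃ G : ℝ → ℝ, ContDiff ℝ (⊤ : ℕ∞) G ∧
      ∀ n, iteratedDeriv n G 1 = q (n + 1) := by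
    refine ⟨fun x => G' (x - 1), hGs'.comp (contDiff_id.sub contDiff_const), fun n => ?_⟩
    rw [iteratedDeriv_comp_sub_const]
    simpa using hG' n
  have hF0 : F 0 = p 1 := by simpa using hF 0
  have hG0 : G 1 = q 1 := by simpa using hG 0
  obtain ⟨δ₀, hδ₀, H0⟩ : ∃ δ > 0, ∀ x, dist x 0 < δ → 0 < F x ∧ F x < p 1 + 1 := by
    have : ∀ᶠ x in nhds (0:ℝ), 0 < F x ∧ F x < p 1 + 1 :=
      (hFs.continuous.continuousAt.eventually (lt_mem_nhds (by rw [hF0]; exact hp1))).and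
        (hFs.continuous.continuousAt.eventually (gt_mem_nhds (by rw [hF0]; linarith)))
    exact Metric.eventually_nhds_iff.1 this
  obtain ⟨δ₁, hδ₁, H1⟩ : ∃ δ > 0, ∀ x, dist x 1 < δ → 0 < G x ∧ G x < q 1 + 1 := by
    have : ∀ᶠ x in nhds (1:ℝ), 0 < G x ∧ G x < q 1 + 1 :=
      (hGs.continuous.continuousAt.eventually (lt_mem_nhds (by rw [hG0]; exact hq1))).and
        (hGs.continuous.continuousAt.eventually (gt_mem_nhds (by rw [hG0]; linarith)))
    exact Metric.eventually_nhds_iff.1 this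
  obtain ⟨ε, hε, he0, he1, he2, he3⟩ : ∃ ε : ℝ, 0 < ε ∧ ε ≤ δ₀ ∧ ε ≤ δ₁ ∧ ε ≤ 1/4 ∧
      ε * ((p 1 + 1) + (q 1 + 1)) < q 0 - p 0 := by
    have hM : 0 < (p 1 + 1) + (q 1 + 1) := by linarith
    refine ⟨min (min δ₀ δ₁) (min (1/4) ((q 0 - p 0) / 2 / ((p 1 + 1) + (q 1 + 1)))), ?_, ?_, ?_,
      ?_, ?_⟩
    · have : 0 < (q 0 - p 0) / 2 / ((p 1 + 1) + (q 1 + 1)) := by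
        apply div_pos _ hM
        linarith
      simp only [lt_min_iff]
      exact ⟨⟨hδ₀, hδ₁⟩, by norm_num, this⟩
    · exact (min_le_left _ _).trans (min_le_left _ _)
    · exact (min_le_left _ _).trans (min_le_right _ _)
    · exact (min_le_right _ _).trans (min_le_left _ _)
    · refine lt_of_le_of_lt (mul_le_mul_of_nonneg_right
        ((min_le_right _ _).trans (min_le_right _ _)) hM.le) ?_
      rw [div_mul_cancel₀ _ hM.ne']
      linarith
  let χ : ContDiffBump (0 : ℝ) := ⟨ε / 2, ε, by linarith, by linarith⟩
  let ψ : ContDiffBump (1 : ℝ) := ⟨ε / 2, ε, by linarith, by linarith⟩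
  have hχs : ContDiff ℝ (⊤ : ℕ∞) χ := χ.contDiff
  have hψs : ContDiff ℝ (⊤ : ℕ∞) ψ := ψ.contDiff
  have hχ0 : ∀ x, ε ≤ dist x 0 → χ x = 0 := fun x hx => χ.zero_of_le_dist hx
  have hψ0 : ∀ x, ε ≤ dist x 1 → ψ x = 0 := fun x hx => ψ.zero_of_le_dist hx
  have hA : ∀ x, 0 ≤ χ x * F x ∧ χ x * F x ≤ p 1 + 1 := by
    intro x
    by_cases hx : ε ≤ dist x 0
    · rw [hχ0 x hx]; constructor <;> linarith
    · have := H0 x (by linarith)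
      have a1 := χ.nonneg (x := x)
      have a2 := χ.le_one (x := x)
      exact ⟨mul_nonneg a1 this.1.le, by nlinarith⟩
  have hB : ∀ x, 0 ≤ ψ x * G x ∧ ψ x * G x ≤ q 1 + 1 := by
    intro x
    by_cases hx : ε ≤ dist x 1
    · rw [hψ0 x hx]; constructor <;> linarith
    · have := H1 x (by linarith)
      have a1 := ψ.nonneg (x := x)
      have a2 := ψ.le_one (x := x)
      exact ⟨mul_nonneg a1 this.1.le, by nlinarith⟩
  have hAc : Continuous fun x => χ x * F x := hχs.continuous.mul hFs.continuous
  have hBc : Continuous fun x => ψ x * G x := hψs.continuous.mul hGs.continuous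
  have hAi : ∫ x in (0:ℝ)..1, χ x * F x ≤ (p 1 + 1) * ε := by
    rw [← intervalIntegral.integral_add_adjacent_intervals (hAc.intervalIntegrable 0 ε)
      (hAc.intervalIntegrable ε 1)]
    have z : ∫ x in ε..1, χ x * F x = 0 := by
      rw [intervalIntegral.integral_congr (g := fun _ => (0:ℝ))]
      · simp
      · intro x hx
        rw [Set.uIcc_of_le (by linarith)] at hx
        have : χ x = 0 := hχ0 x (by
          rw [Real.dist_eq, sub_zero]; exact hx.1.trans (le_abs_self x))
        simp [this]
    rw [z, add_zero]
    have := intervalIntegral.norm_integral_le_of_norm_le_const (a := 0) (b := ε) (C := p 1 + 1)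
      (f := fun x => χ x * F x) (fun x _ => by rw [Real.norm_of_nonneg (hA x).1]; exact (hA x).2)
    rw [sub_zero, abs_of_pos hε] at this
    exact (le_abs_self _).trans this
  have hBi : ∫ x in (0:ℝ)..1, ψ x * G x ≤ (q 1 + 1) * ε := by
    rw [← intervalIntegral.integral_add_adjacent_intervals (hBc.intervalIntegrable 0 (1 - ε))
      (hBc.intervalIntegrable (1 - ε) 1)]
    have z : ∫ x in (0:ℝ)..(1 - ε), ψ x * G x = 0 := by
      rw [intervalIntegral.integral_congr (g := fun _ => (0:ℝ))]
      · simp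
      · intro x hx
        rw [Set.uIcc_of_le (by linarith)] at hx
        have : ψ x = 0 := hψ0 x (by
          rw [Real.dist_eq, abs_sub_comm]
          exact le_trans (by linarith [hx.2]) (le_abs_self (1 - x)))
        simp [this]
    rw [z, zero_add]
    have := intervalIntegral.norm_integral_le_of_norm_le_const (a := 1 - ε) (b := 1) (C := q 1 + 1)
      (f := fun x => ψ x * G x) (fun x _ => by rw [Real.norm_of_nonneg (hB x).1]; exact (hB x).2)
    rw [sub_sub_cancel, abs_of_pos hε] at this
    exact (le_abs_self _).trans this
  let k : ℝ → ℝ := fun x => (1 - χ x) * (1 - ψ x)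
  have hks : ContDiff ℝ (⊤ : ℕ∞) k := (contDiff_const.sub hχs).mul (contDiff_const.sub hψs)
  have hk0 : ∀ x, 0 ≤ k x := fun x =>
    mul_nonneg (sub_nonneg.2 χ.le_one) (sub_nonneg.2 ψ.le_one)
  have hkI : 0 < ∫ x in (0:ℝ)..1, k x := by
    refine intervalIntegral.integral_pos one_pos hks.continuous.continuousOn (fun x _ => hk0 x)
      ⟨1/2, by norm_num, ?_⟩
    have e1 : χ (1/2) = 0 := hχ0 _ (by
      rw [Real.dist_eq, abs_of_pos (by norm_num)]; linarith)
    have e2 : ψ (1/2) = 0 := hψ0 _ (by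
      rw [Real.dist_eq, abs_of_neg (by norm_num)]; linarith)
    simp only [k]
    rw [e1, e2]
    norm_num
  set I := ∫ x in (0:ℝ)..1, k x with hI
  set J := (∫ x in (0:ℝ)..1, χ x * F x) + ∫ x in (0:ℝ)..1, ψ x * G x with hJ
  have hJl : J < q 0 - p 0 := by nlinarith
  let c : ℝ := (q 0 - p 0 - J) / I
  have hc : 0 < c := div_pos (by linarith) hkI
  let u : ℝ → ℝ := fun x => (χ x * F x + ψ x * G x) + c * k x
  have hus : ContDiff ℝ (⊤ : ℕ∞) u :=
    ((hχs.mul hFs).add (hψs.mul hGs)).add (contDiff_const.mul hks)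
  have huI : ∫ x in (0:ℝ)..1, u x = q 0 - p 0 := by
    simp only [u]
    have i1 : Continuous fun x => χ x * F x + ψ x * G x := hAc.add hBc
    have i2 : Continuous fun x => c * k x := continuous_const.mul hks.continuous
    rw [intervalIntegral.integral_add (i1.intervalIntegrable _ _) (i2.intervalIntegrable _ _),
      intervalIntegral.integral_add (hAc.intervalIntegrable _ _) (hBc.intervalIntegrable _ _),
      intervalIntegral.integral_const_mul, ← hI, ← hJ]
    simp only [c]
    rw [div_mul_cancel₀ _ hkI.ne']
    ring
  have hupos : ∀ x, 0 < u x := by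
    intro x
    have a := (hA x).1
    have b := (hB x).1
    have kk := mul_nonneg hc.le (hk0 x)
    by_cases h1 : χ x = 1
    · have : 0 < F x := (H0 x (by
        by_contra hcon
        have := hχ0 x (by linarith)
        rw [h1] at this
        exact one_ne_zero this)).1
      have : 0 < χ x * F x := by rw [h1, one_mul]; exact this
      simp only [u]; linarith
    by_cases h2 : ψ x = 1
    · have : 0 < G x := (H1 x (by
        by_contra hcon
        have := hψ0 x (by linarith)
        rw [h2] at this
        exact one_ne_zero this)).1
      have : 0 < ψ x * G x := by rw [h2, one_mul]; exact this
      simp only [u]; linarith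
    have : 0 < c * k x := mul_pos hc (mul_pos
      (sub_pos.2 (lt_of_le_of_ne χ.le_one h1)) (sub_pos.2 (lt_of_le_of_ne ψ.le_one h2)))
    simp only [u]; linarith
  obtain ⟨m, hm, hmu⟩ : ∃ m > 0, ∀ x, m ≤ u x := by
    obtain ⟨y, _, hy⟩ := (isCompact_Icc (a := (-1:ℝ)) (b := 2)).exists_isMinOn
      ⟨0, by norm_num⟩ hus.continuous.continuousOn
    refine ⟨min (u y) c, lt_min (hupos y) hc, fun x => ?_⟩
    by_cases hx : x ∈ Set.Icc (-1:ℝ) 2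
    · exact (min_le_left _ _).trans (hy hx)
    · have hx' : x < -1 ∨ 2 < x := by
        by_contra hcon
        push Not at hcon
        exact hx hcon
      have e1 : χ x = 0 := hχ0 _ (by
        rw [Real.dist_eq]
        rcases hx' with h | h
        · exact le_trans (by linarith) (neg_le_abs _)
        · exact le_trans (by linarith) (le_abs_self _))
      have e2 : ψ x = 0 := hψ0 _ (by
        rw [Real.dist_eq]
        rcases hx' with h | h
        · exact le_trans (by linarith) (neg_le_abs _)
        · exact le_trans (by linarith) (le_abs_self _))
      have : u x = c := by simp [u, k, e1, e2]
      rw [this]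
      exact min_le_right _ _
  let g : ℝ → ℝ := fun x => p 0 + ∫ t in (0:ℝ)..x, u t
  have hgd : ∀ x, HasDerivAt g (u x) x := fun x =>
    (intervalIntegral.integral_hasDerivAt_right (hus.continuous.intervalIntegrable _ _)
      (hus.continuous.stronglyMeasurableAtFilter _ _) hus.continuous.continuousAt).const_add _
  have hgdiff : Differentiable ℝ g := fun x => (hgd x).differentiableAt
  have hgu : deriv g = u := funext fun x => (hgd x).deriv
  have hu0 : u =ᶠ[nhds 0] F := by
    filter_upwards [χ.eventuallyEq_one, Metric.ball_mem_nhds (0:ℝ) (by norm_num : (0:ℝ) < 1/2)]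
      with x hx hx2
    have e2 : ψ x = 0 := hψ0 _ (by
      rw [Metric.mem_ball, Real.dist_eq, abs_lt] at hx2
      rw [Real.dist_eq]
      exact le_trans (by linarith) (neg_le_abs _))
    simp [u, k, hx, e2]
  have hu1 : u =ᶠ[nhds 1] G := by
    filter_upwards [ψ.eventuallyEq_one, Metric.ball_mem_nhds (1:ℝ) (by norm_num : (0:ℝ) < 1/2)]
      with x hx hx2
    have e2 : χ x = 0 := hχ0 _ (by
      rw [Metric.mem_ball, Real.dist_eq, abs_lt] at hx2
      rw [Real.dist_eq]
      exact le_trans (by linarith) (le_abs_self _))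
    simp [u, k, hx, e2]
  refine ⟨g, contDiff_infty_iff_deriv.2 ⟨hgdiff, by rw [hgu]; exact hus⟩, ?_, ?_, ?_, ?_⟩
  · have key := mul_sub_le_image_sub_of_le_deriv hgdiff (C := m) (by rw [hgu]; exact hmu)
    refine hgdiff.continuous.surjective ?_ ?_
    · refine Filter.tendsto_atTop_mono' _ (f₁ := fun x => m * x + g 0) ?_ ?_
      · filter_upwards [Filter.eventually_ge_atTop 0] with x hx
        have := key hx
        linarith
      · exact Filter.tendsto_atTop_add_const_right _ _
          (Filter.Tendsto.const_mul_atTop hm Filter.tendsto_id)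
    · refine Filter.tendsto_atBot_mono' _ (f₁ := fun x => m * x + g 0) ?_ ?_
      · filter_upwards [Filter.eventually_le_atBot 0] with x hx
        have := key hx
        linarith
      · exact Filter.tendsto_atBot_add_const_right _ _
          (Filter.Tendsto.const_mul_atBot hm Filter.tendsto_id)
  · rw [hgu]; exact hupos
  · intro n
    cases n with
    | zero => simp [g]
    | succ n => rw [iteratedDeriv_succ', hgu, hu0.iteratedDeriv_eq, hF]
  · intro n
    cases n with
    | zero => simp [g, huI]
    | succ n => rw [iteratedDeriv_succ', hgu, hu1.iteratedDeriv_eq, hG]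


/-- for sequences `p, q` with `p 0 < q 0`, `p 1 > 0`, `q 1 > 0`
there is an orientation-preserving C^∞ diffeomorphism of ℝ with jet `p` at `0`
and jet `q` at `1`; consequently the two-point jet map is onto the set of such
pairs. -/
theorem stmt_14 (p q : ℕ → ℝ) (h0 : p 0 < q 0) (hp1 : 0 < p 1) (hq1 : 0 < q 1) :
    (∃ g : ℝ → ℝ, ContDiff ℝ (⊤ : ℕ∞) g ∧ Function.Surjective g ∧
        (∀ x : ℝ, 0 < deriv g x) ∧
        (∀ n : ℕ, iteratedDeriv n g 0 = p n) ∧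
        (∀ n : ℕ, iteratedDeriv n g 1 = q n)) ∧
      {pq : (ℕ → ℝ) × (ℕ → ℝ) |
          ∃ g : ℝ → ℝ, ContDiff ℝ (⊤ : ℕ∞) g ∧ Function.Surjective g ∧
            (∀ x : ℝ, 0 < deriv g x) ∧
            (∀ n : ℕ, iteratedDeriv n g 0 = pq.1 n) ∧
            (∀ n : ℕ, iteratedDeriv n g 1 = pq.2 n)} =
        {pq : (ℕ → ℝ) × (ℕ → ℝ) | pq.1 0 < pq.2 0 ∧ 0 < pq.1 1 ∧ 0 < pq.2 1} := by
  refine ⟨jet_exists p q h0 hp1 hq1, Set.ext fun pq => ⟨?_, fun h => ?_⟩⟩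
  · rintro ⟨g, _, _, hd, h0, h1⟩
    refine ⟨?_, ?_, ?_⟩
    · have := strictMono_of_deriv_pos hd one_pos
      rw [← h0 0, ← h1 0]
      simpa using this
    · rw [← h0 1, iteratedDeriv_one]; exact hd 0
    · rw [← h1 1, iteratedDeriv_one]; exact hd 1
  · exact jet_exists pq.1 pq.2 h.1 h.2.1 h.2.2
end

section
/- Let F : ℤ → ℕ → ℝ be a double sequence such that: F(a)(0) < F(b)(0) whenever a < b in ℤ; the set {F(a)(0) : a ∈ ℤ} is unbounded below and unbounded above in ℝ; and F(a)(1) > 0 for every a ∈ ℤ. Then there exists a surjective C^∞ function g : ℝ → ℝ with g'(x) > 0 for all x ∈ ℝ such that g^(n)(a) = F(a)(n) for every a ∈ ℤ and every n ∈ ℕ. -/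
open scoped ContDiff

lemma bdd_of_cs (f : ℝ → ℝ) (hf : ContDiff ℝ ∞ f) (hc : HasCompactSupport f) (k : ℕ) :
    ∃ M : ℝ, 0 ≤ M ∧ ∀ x, ‖iteratedDeriv k f x‖ ≤ M := by
  have h2 : HasCompactSupport (iteratedFDeriv ℝ k f) := hc.iteratedFDeriv k
  have h1 : Continuous (iteratedFDeriv ℝ k f) := hf.continuous_iteratedFDeriv (by exact_mod_cast le_top)
  obtain ⟨M, hM⟩ := h2.exists_bound_of_continuous h1
  refine ⟨M, (norm_nonneg _).trans (hM 0), fun x => ?_⟩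
  rw [← norm_iteratedFDeriv_eq_norm_iteratedDeriv]
  exact hM x

lemma borel_term (c : ℝ) (n : ℕ) : ∃ f : ℝ → ℝ, ContDiff ℝ ∞ f ∧ HasCompactSupport f ∧
    (∀ k, iteratedDeriv k f 0 = if k = n then c else 0) ∧
    ∀ k < n, ∀ x, ‖iteratedDeriv k f x‖ ≤ (1/2) ^ n := by
  let χ : ContDiffBump (0:ℝ) := ⟨1, 2, by norm_num, by norm_num⟩
  let φ : ℝ → ℝ := fun y => c / n.factorial * (y ^ n * χ y)
  have hφ : ContDiff ℝ ∞ φ := contDiff_const.mul ((contDiff_id.pow n).mul χ.contDiff)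
  have hφc : HasCompactSupport φ := (χ.hasCompactSupport.mul_left).mul_left
  choose M hM0 hM using fun k => bdd_of_cs φ hφ hφc k
  let S := ∑ k ∈ Finset.range n, M k
  have hS : 0 ≤ S := Finset.sum_nonneg fun k _ => hM0 k
  let L : ℝ := 1 + 2 ^ n * S
  have hL1 : 1 ≤ L := by simp only [L]; nlinarith [pow_pos (two_pos : (0:ℝ) < 2) n, mul_nonneg (pow_pos (two_pos : (0:ℝ) < 2) n).le hS]
  have hL0 : L ≠ 0 := by positivity
  have hder : ∀ k x, iteratedDeriv k (fun x => (L⁻¹) ^ n * φ (L * x)) x = (L⁻¹) ^ n * (L ^ k * iteratedDeriv k φ (L * x)) := by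
    intro k x
    rw [iteratedDeriv_const_mul_field]
    rw [iteratedDeriv_comp_const_mul (hφ.of_le (by exact_mod_cast le_top))]
  refine ⟨fun x => (L⁻¹) ^ n * φ (L * x), ?_, ?_, ?_, ?_⟩
  · exact contDiff_const.mul (hφ.comp (contDiff_const.mul contDiff_id))
  · have := hφc.comp_homeomorph (Homeomorph.mulLeft₀ L hL0)
    exact HasCompactSupport.mul_left this
  · intro k
    rw [hder]
    have e : φ =ᶠ[nhds 0] fun y => c / n.factorial * y ^ n := by
      filter_upwards [χ.eventuallyEq_one] with y hy
      simp [φ, hy]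
    rw [mul_zero, e.iteratedDeriv_eq, iteratedDeriv_const_mul_field, iteratedDeriv_fun_pow_zero]
    split_ifs with h
    · subst h
      have : (k.factorial : ℝ) ≠ 0 := by positivity
      rw [inv_pow]; field_simp
    · simp
  · intro k hk x
    rw [hder, norm_mul, norm_mul, norm_pow, norm_pow, norm_inv, Real.norm_of_nonneg (by positivity : 0 ≤ L)]
    have h1 : ‖iteratedDeriv k φ (L * x)‖ ≤ S :=
      (hM k _).trans (Finset.single_le_sum (fun i _ => hM0 i) (Finset.mem_range.2 hk))
    have h2 : L⁻¹ ^ n * L ^ k ≤ L⁻¹ := by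
      obtain ⟨m, rfl⟩ := Nat.exists_eq_add_of_lt hk
      have : L⁻¹ ^ (k + m + 1) * L ^ k = L⁻¹ * L⁻¹ ^ m := by
        rw [pow_succ, pow_add, inv_pow]; field_simp
      rw [this]
      exact mul_le_of_le_one_right (by positivity) (pow_le_one₀ (by positivity) (inv_le_one_of_one_le₀ hL1))
    calc _ = (L⁻¹ ^ n * L ^ k) * ‖iteratedDeriv k φ (L * x)‖ := by ring
      _ ≤ L⁻¹ * S := by gcongr
      _ ≤ (1/2)^n := by
        rw [inv_mul_le_iff₀ (by positivity)]
        have : (1/2:ℝ)^n * 2^n = 1 := by rw [← mul_pow]; norm_num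
        have h3 : L * (1/2:ℝ)^n = (1/2)^n + S * ((1/2:ℝ)^n * 2^n) := by simp only [L]; ring
        rw [h3, this]; have : (0:ℝ) < (1/2)^n := by positivity
        linarith

lemma borelJet (c : ℕ → ℝ) : ∃ f : ℝ → ℝ, ContDiff ℝ ∞ f ∧ ∀ k, iteratedDeriv k f 0 = c k := by
  choose f hf hc h0 hb using fun n => borel_term (c n) n
  choose M hM0 hM using fun (k n : ℕ) => bdd_of_cs (f n) (hf n) (hc n) k
  let v : ℕ → ℕ → ℝ := fun k n => if k < n then (1/2) ^ n else M k n
  have hv : ∀ k : ℕ, ((k : ℕ∞) ≤ (⊤ : ℕ∞)) → Summable (v k) := by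
    intro k _
    have : Summable (fun n : ℕ => (1/2 : ℝ) ^ n) := summable_geometric_two
    refine (summable_congr_cofinite ?_).2 this
    rw [Nat.cofinite_eq_atTop]
    filter_upwards [Filter.eventually_gt_atTop k] with n hn
    simp [v, hn]
  have hv2 : ∀ (k n : ℕ) (x : ℝ), ((k : ℕ∞) ≤ (⊤ : ℕ∞)) → ‖iteratedFDeriv ℝ k (f n) x‖ ≤ v k n := by
    intro k n x _
    rw [norm_iteratedFDeriv_eq_norm_iteratedDeriv]
    simp only [v]
    split_ifs with h
    · exact hb n k h x
    · exact hM k n x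
  refine ⟨fun x => ∑' n, f n x, contDiff_tsum hf hv hv2, fun k => ?_⟩
  rw [iteratedDeriv_eq_iteratedFDeriv, iteratedFDeriv_tsum_apply hf hv hv2 le_top]
  have hs : Summable fun n => iteratedFDeriv ℝ k (f n) 0 :=
    .of_norm_bounded (hv k le_top) fun n => hv2 k n 0 le_top
  rw [ContinuousMultilinearMap.tsum_eval hs]
  simp_rw [← iteratedDeriv_eq_iteratedFDeriv, h0]
  simp

lemma iterD_cont {f : ℝ → ℝ} (hf : ContDiff ℝ ∞ f) (n : ℕ) : Continuous (iteratedDeriv n f) :=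
  hf.continuous_iteratedDeriv n (by exact_mod_cast le_top)

lemma flat_of_lt {f : ℝ → ℝ} (hf : ContDiff ℝ ∞ f) (a : ℝ) (h : ∀ x < a, f x = 0) (n : ℕ) :
    iteratedDeriv n f a = 0 := by
  have h1 : ∀ x ∈ Set.Iio a, iteratedDeriv n f x = 0 := by
    intro x hx
    have : f =ᶠ[nhds x] fun _ => 0 := by
      filter_upwards [Iio_mem_nhds hx] with y hy using h y hy
    rw [this.iteratedDeriv_eq]; simp [iteratedDeriv_const]
  have hc : IsClosed {x | iteratedDeriv n f x = 0} := isClosed_eq (iterD_cont hf n) continuous_const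
  have := closure_minimal (s := Set.Iio a) h1 hc
  rw [closure_Iio] at this
  exact this (Set.mem_Iic.2 le_rfl)

lemma flat_of_gt {f : ℝ → ℝ} (hf : ContDiff ℝ ∞ f) (a : ℝ) (h : ∀ x, a < x → f x = 0) (n : ℕ) :
    iteratedDeriv n f a = 0 := by
  have h1 : ∀ x ∈ Set.Ioi a, iteratedDeriv n f x = 0 := by
    intro x hx
    have : f =ᶠ[nhds x] fun _ => 0 := by
      filter_upwards [Ioi_mem_nhds hx] with y hy using h y hy
    rw [this.iteratedDeriv_eq]; simp [iteratedDeriv_const]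
  have hc : IsClosed {x | iteratedDeriv n f x = 0} := isClosed_eq (iterD_cont hf n) continuous_const
  have := closure_minimal (s := Set.Ioi a) h1 hc
  rw [closure_Ioi] at this
  exact this (Set.mem_Ici.2 le_rfl)

/-- cutting off a flat function -/
lemma cut_hasDeriv {u : ℝ → ℝ} (hu : ContDiff ℝ ∞ u) (a : ℝ) (h0 : ∀ n, iteratedDeriv n u a = 0) (x : ℝ) :
    HasDerivAt (fun x => if a ≤ x then u x else 0) (if a ≤ x then deriv u x else 0) x := by
  have hd : ∀ x, HasDerivAt u (deriv u x) x := fun x =>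
    ((hu.differentiable (by simp)) x).hasDerivAt
  have ha0 : u a = 0 := by simpa using h0 0
  have ha1 : deriv u a = 0 := by simpa using h0 1
  rcases lt_trichotomy x a with h | h | h
  · rw [if_neg (not_le.2 h)]
    refine (hasDerivAt_const x (0:ℝ)).congr_of_eventuallyEq ?_
    filter_upwards [Iio_mem_nhds h] with y hy
    rw [if_neg (not_le.2 hy)]
  · subst h
    rw [if_pos le_rfl, ha1]
    have h1 := hd x
    rw [ha1, hasDerivAt_iff_isLittleO] at h1
    rw [hasDerivAt_iff_isLittleO]
    refine Asymptotics.IsBigO.trans_isLittleO ?_ h1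
    refine Asymptotics.isBigO_of_le _ fun y => ?_
    simp only [le_refl, if_true, ha0, smul_zero, sub_zero]
    split_ifs <;> simp
  · rw [if_pos h.le]
    refine (hd x).congr_of_eventuallyEq ?_
    filter_upwards [Ioi_mem_nhds h] with y hy
    rw [if_pos (le_of_lt hy)]

lemma cut_contDiff_nat (a : ℝ) (m : ℕ) : ∀ (u : ℝ → ℝ), ContDiff ℝ ∞ u → (∀ n, iteratedDeriv n u a = 0) →
    ContDiff ℝ m (fun x => if a ≤ x then u x else 0) := by
  induction m with
  | zero =>
    intro u hu h0
    have : Differentiable ℝ (fun x => if a ≤ x then u x else 0) :=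
      fun x => (cut_hasDeriv hu a h0 x).differentiableAt
    simpa using this.continuous
  | succ m ih =>
    intro u hu h0
    rw [Nat.cast_add_one, contDiff_succ_iff_deriv]
    refine ⟨fun x => (cut_hasDeriv hu a h0 x).differentiableAt, by simp, ?_⟩
    rw [funext fun x => (cut_hasDeriv hu a h0 x).deriv]
    exact ih _ (contDiff_infty_iff_deriv.1 hu).2 fun n => by rw [← iteratedDeriv_succ']; exact h0 _

/-- gluing two functions with the same jet -/
lemma glue {f g : ℝ → ℝ} (hf : ContDiff ℝ ∞ f) (hg : ContDiff ℝ ∞ g) (a : ℝ)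
    (h : ∀ n, iteratedDeriv n f a = iteratedDeriv n g a) :
    ContDiff ℝ ∞ (fun x => if a ≤ x then g x else f x) ∧
    ∀ n, iteratedDeriv n (fun x => if a ≤ x then g x else f x) a = iteratedDeriv n g a := by
  have hA : ∀ (u : ℝ → ℝ) (n : ℕ), ContDiff ℝ ∞ u → ContDiffAt ℝ n u a := fun u n hu =>
    (hu.of_le (by exact_mod_cast le_top)).contDiffAt
  have hu : ContDiff ℝ ∞ (g - f) := hg.sub hf
  have h0 : ∀ n, iteratedDeriv n (g - f) a = 0 := fun n => by
    rw [iteratedDeriv_sub (hA _ _ hg) (hA _ _ hf), h, sub_self]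
  have hc : ContDiff ℝ ∞ (fun x => if a ≤ x then (g - f) x else 0) :=
    contDiff_infty.2 fun m => cut_contDiff_nat a m _ hu h0
  have e : (fun x => if a ≤ x then g x else f x) = f + (fun x => if a ≤ x then (g - f) x else 0) := by
    funext x; simp only [Pi.add_apply, Pi.sub_apply]; split_ifs <;> ring
  rw [e]
  refine ⟨hf.add hc, fun n => ?_⟩
  rw [iteratedDeriv_add (hA _ _ hf) (hA _ _ hc), flat_of_lt hc a, add_zero, h]
  intro x hx
  rw [if_neg (not_le.2 hx)]

lemma localJet (c : ℕ → ℝ) (h0 : 0 < c 0) (ε : ℝ) (hε : 0 < ε) : ∃ H : ℝ → ℝ, ContDiff ℝ ∞ H ∧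
    (∀ n, iteratedDeriv n H 0 = c n) ∧ (∀ x, 0 ≤ H x) ∧ (∀ x, 1/2 ≤ |x| → H x = 0) ∧
    (∫ x in (0:ℝ)..1, H x) ≤ ε ∧ (∫ x in (-1:ℝ)..0, H x) ≤ ε := by
  obtain ⟨B, hB, hj⟩ := borelJet c
  have hB0 : B 0 = c 0 := by simpa using hj 0
  have e1 : ∀ᶠ x in nhds (0:ℝ), B x ∈ Set.Ioo 0 (2 * c 0) := by
    apply hB.continuous.continuousAt
    rw [hB0]; exact Ioo_mem_nhds h0 (by linarith)
  obtain ⟨r, hr, hrB⟩ := Metric.eventually_nhds_iff.1 e1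
  set δ : ℝ := min (min r (1/2)) (ε / (2 * c 0)) with hδ
  have hδ0 : 0 < δ := by positivity
  have hδr : δ ≤ r := (min_le_left _ _).trans (min_le_left _ _)
  have hδh : δ ≤ 1/2 := (min_le_left _ _).trans (min_le_right _ _)
  have hδe : 2 * c 0 * δ ≤ ε := by
    have : δ ≤ ε / (2 * c 0) := min_le_right _ _
    rw [le_div_iff₀ (by positivity)] at this; linarith
  let χ : ContDiffBump (0:ℝ) := ⟨δ/2, δ, by positivity, by linarith⟩
  let H : ℝ → ℝ := fun x => χ x * B x
  have hH : ContDiff ℝ ∞ H := χ.contDiff.mul hB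
  have hz : ∀ x, δ ≤ |x| → H x = 0 := by
    intro x hx
    have : χ x = 0 := χ.zero_of_le_dist (by simpa [χ] using hx)
    simp [H, this]
  have hn : ∀ x, 0 ≤ H x ∧ H x ≤ 2 * c 0 := by
    intro x
    by_cases hx : δ ≤ |x|
    · rw [hz x hx]; exact ⟨le_rfl, by positivity⟩
    · have := hrB (y := x) (by simpa using (not_le.1 hx).trans_le hδr)
      refine ⟨mul_nonneg χ.nonneg this.1.le, ?_⟩
      calc χ x * B x ≤ 1 * B x := by gcongr; exact this.1.le; exact χ.le_one
        _ ≤ 2 * c 0 := by linarith [this.2]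
  have hi : ∀ a b, IntervalIntegrable H MeasureTheory.volume a b := fun a b => hH.continuous.intervalIntegrable a b
  refine ⟨H, hH, ?_, fun x => (hn x).1, fun x hx => hz x (hδh.trans hx), ?_, ?_⟩
  · intro n
    have : H =ᶠ[nhds 0] B := by
      filter_upwards [χ.eventuallyEq_one] with y hy
      simp [H, hy]
    rw [this.iteratedDeriv_eq, hj]
  · rw [← intervalIntegral.integral_add_adjacent_intervals (hi 0 δ) (hi δ 1)]
    have z : ∫ x in δ..1, H x = 0 := by
      apply intervalIntegral.integral_zero_ae
      refine Filter.Eventually.of_forall fun x hx => hz x ?_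
      rw [Set.uIoc_of_le (by linarith)] at hx
      exact hx.1.le.trans (le_abs_self x)
    have b := intervalIntegral.norm_integral_le_of_norm_le_const (a := 0) (b := δ) (f := H) (C := 2 * c 0)
      (fun x _ => by rw [Real.norm_of_nonneg (hn x).1]; exact (hn x).2)
    rw [sub_zero, abs_of_pos hδ0] at b
    linarith [(Real.le_norm_self _).trans b]
  · rw [← intervalIntegral.integral_add_adjacent_intervals (hi (-1) (-δ)) (hi (-δ) 0)]
    have z : ∫ x in (-1)..(-δ), H x = 0 := by
      apply intervalIntegral.integral_zero_ae
      refine Filter.Eventually.of_forall fun x hx => hz x ?_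
      rw [Set.uIoc_of_le (by linarith)] at hx
      have := neg_le_abs x
      linarith [hx.2]
    have b := intervalIntegral.norm_integral_le_of_norm_le_const (a := -δ) (b := 0) (f := H) (C := 2 * c 0)
      (fun x _ => by rw [Real.norm_of_nonneg (hn x).1]; exact (hn x).2)
    rw [zero_sub, neg_neg, abs_of_pos hδ0] at b
    linarith [(Real.le_norm_self _).trans b]

lemma shift_iter (f : ℝ → ℝ) (n : ℕ) (s x : ℝ) :
    iteratedDeriv n (fun y => f (y - s)) x = iteratedDeriv n f (x - s) := by
  have := iteratedDeriv_comp_sub_const n f s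
  rw [this]

lemma segment_fun (p q : ℕ → ℝ) (h : p 0 < q 0) (hp : 0 < p 1) (hq : 0 < q 1) :
    ∃ G : ℝ → ℝ, ContDiff ℝ ∞ G ∧ (∀ n, iteratedDeriv n G 0 = p n) ∧
      (∀ n, iteratedDeriv n G 1 = q n) ∧ ∀ x, 0 ≤ x → x ≤ 1 → 0 < deriv G x := by
  set ε := (q 0 - p 0) / 3 with hε
  have hε0 : 0 < ε := by rw [hε]; linarith
  obtain ⟨A, hA, hAj, hAn, hAz, hAi, -⟩ := localJet (fun n => p (n+1)) hp ε hε0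
  obtain ⟨C, hC, hCj, hCn, hCz, -, hCi⟩ := localJet (fun n => q (n+1)) hq ε hε0
  let D : ℝ → ℝ := fun x => C (x - 1)
  have hD : ContDiff ℝ ∞ D := hC.comp (contDiff_id.sub contDiff_const)
  let ψ : ℝ → ℝ := fun x => expNegInvGlue x * expNegInvGlue (1 - x)
  have hψ : ContDiff ℝ ∞ ψ := expNegInvGlue.contDiff.mul
    (expNegInvGlue.contDiff.comp (contDiff_const.sub contDiff_id))
  have hψpos : ∀ x ∈ Set.Ioo (0:ℝ) 1, 0 < ψ x := fun x hx =>
    mul_pos (expNegInvGlue.pos_of_pos hx.1) (expNegInvGlue.pos_of_pos (by linarith [hx.2]))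
  have hψn : ∀ x, 0 ≤ ψ x := fun x => mul_nonneg (expNegInvGlue.nonneg _) (expNegInvGlue.nonneg _)
  have hi : ∀ {f : ℝ → ℝ}, ContDiff ℝ ∞ f → ∀ a b, IntervalIntegrable f MeasureTheory.volume a b :=
    fun hf a b => hf.continuous.intervalIntegrable a b
  have hI : 0 < ∫ x in (0:ℝ)..1, ψ x :=
    intervalIntegral.intervalIntegral_pos_of_pos_on (hi hψ 0 1) hψpos one_pos
  have hDi : (∫ x in (0:ℝ)..1, D x) ≤ ε := by
    simp only [D]
    rw [intervalIntegral.integral_comp_sub_right (fun x => C x)]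
    simpa using hCi
  set IA := ∫ x in (0:ℝ)..1, A x
  set ID := ∫ x in (0:ℝ)..1, D x
  set I := ∫ x in (0:ℝ)..1, ψ x
  set k := (q 0 - p 0 - IA - ID) / I with hk
  have hk0 : 0 < k := div_pos (by linarith) hI
  let E : ℝ → ℝ := fun x => k * ψ x
  have hE : ContDiff ℝ ∞ E := contDiff_const.mul hψ
  let H : ℝ → ℝ := A + D + E
  have hH : ContDiff ℝ ∞ H := (hA.add hD).add hE
  have hcd : ∀ {u : ℝ → ℝ} (n : ℕ) (x : ℝ), ContDiff ℝ ∞ u → ContDiffAt ℝ n u x := fun n x hu =>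
    (hu.of_le (by exact_mod_cast le_top)).contDiffAt
  have hHj : ∀ n x, iteratedDeriv n H x = iteratedDeriv n A x + iteratedDeriv n C (x - 1) + k * iteratedDeriv n ψ x := by
    intro n x
    simp only [H]
    rw [iteratedDeriv_add (hcd (u := A + D) n x (hA.add hD)) (hcd n x hE), iteratedDeriv_add (hcd n x hA) (hcd n x hD)]
    simp only [D, E]
    rw [shift_iter, iteratedDeriv_const_mul_field]
  have hfar : ∀ (u : ℝ → ℝ), (∀ x, 1/2 ≤ |x| → u x = 0) → ∀ n x, |x| = 1 → iteratedDeriv n u x = 0 := by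
    intro u hu n x hx
    have : u =ᶠ[nhds x] fun _ => 0 := by
      have : ∀ᶠ y in nhds x, 1/2 < |y| := continuous_abs.continuousAt.eventually (lt_mem_nhds (by rw [hx]; norm_num))
      filter_upwards [this] with y hy using hu y hy.le
    rw [this.iteratedDeriv_eq]; simp [iteratedDeriv_const]
  have hψ0 : ∀ n, iteratedDeriv n ψ 0 = 0 := flat_of_lt hψ 0 fun x hx => by
    simp [ψ, expNegInvGlue.zero_of_nonpos hx.le]
  have hψ1 : ∀ n, iteratedDeriv n ψ 1 = 0 := flat_of_gt hψ 1 fun x hx => by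
    simp only [ψ]; rw [expNegInvGlue.zero_of_nonpos (x := 1 - x) (by linarith), mul_zero]
  have hH0 : ∀ n, iteratedDeriv n H 0 = p (n+1) := fun n => by
    rw [hHj, hψ0, hAj, hfar C hCz n _ (by norm_num)]; simp
  have hH1 : ∀ n, iteratedDeriv n H 1 = q (n+1) := fun n => by
    rw [hHj, hψ1, hfar A hAz n _ (by norm_num), sub_self, hCj]; simp
  let G : ℝ → ℝ := fun x => p 0 + ∫ t in (0:ℝ)..x, H t
  have hGd : ∀ x, HasDerivAt G (H x) x := fun x =>
    (intervalIntegral.integral_hasDerivAt_right (hi hH 0 x)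
      (hH.continuous.stronglyMeasurableAtFilter _ _) hH.continuous.continuousAt).const_add _
  have hGd' : deriv G = H := funext fun x => (hGd x).deriv
  refine ⟨G, contDiff_infty_iff_deriv.2 ⟨fun x => (hGd x).differentiableAt, hGd' ▸ hH⟩, ?_, ?_, ?_⟩
  · intro n
    cases n with
    | zero => simp [G]
    | succ n => rw [iteratedDeriv_succ', hGd', hH0]
  · intro n
    cases n with
    | zero =>
      have e : ∫ t in (0:ℝ)..1, H t = IA + ID + k * I := by
        simp only [H, Pi.add_apply, E]
        rw [intervalIntegral.integral_add ((hi hA 0 1).add (hi hD 0 1)) (hi hE 0 1),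
          intervalIntegral.integral_add (hi hA 0 1) (hi hD 0 1), intervalIntegral.integral_const_mul]
      simp only [iteratedDeriv_zero, G]
      rw [e, hk, div_mul_cancel₀ _ hI.ne']; ring
    | succ n => rw [iteratedDeriv_succ', hGd', hH1]
  · intro x hx0 hx1
    rw [hGd']
    have h0 := hH0 0
    have h1 := hH1 0
    simp only [iteratedDeriv_zero, zero_add] at h0 h1
    rcases hx0.eq_or_lt with rfl | hx0
    · rw [h0]; exact hp
    rcases hx1.eq_or_lt with rfl | hx1
    · rw [h1]; exact hq
    have a1 := hAn x
    have a2 := hCn (x - 1)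
    have a3 := mul_pos hk0 (hψpos x ⟨hx0, hx1⟩)
    simp only [H, Pi.add_apply, D, E]
    linarith

/-- interpolation of an admissible double sequence of jets on ℤ by
an orientation-preserving C^∞ diffeomorphism of ℝ. -/
theorem stmt_15 (F : ℤ → ℕ → ℝ)
    (hmono : ∀ a b : ℤ, a < b → F a 0 < F b 0)
    (hbelow : ¬ BddBelow (Set.range fun a : ℤ => F a 0))
    (habove : ¬ BddAbove (Set.range fun a : ℤ => F a 0))
    (hpos : ∀ a : ℤ, 0 < F a 1) :
    ∃ g : ℝ → ℝ, ContDiff ℝ (⊤ : ℕ∞) g ∧ Function.Surjective g ∧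
      (∀ x : ℝ, 0 < deriv g x) ∧
      ∀ a : ℤ, ∀ n : ℕ, iteratedDeriv n g a = F a n := by
  choose G hG hG0 hG1 hGpos using fun a : ℤ =>
    segment_fun (F a) (F (a+1)) (hmono a (a+1) (by omega)) (hpos a) (hpos (a+1))
  let T : ℤ → ℝ → ℝ := fun a x => G a (x - a)
  have hT : ∀ a, ContDiff ℝ ∞ (T a) := fun a => (hG a).comp (contDiff_id.sub contDiff_const)
  have hTj : ∀ a n x, iteratedDeriv n (T a) x = iteratedDeriv n (G a) (x - a) := fun a n x => shift_iter _ _ _ _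
  have hT0 : ∀ a n, iteratedDeriv n (T a) a = F a n := fun a n => by rw [hTj, sub_self, hG0]
  have hT1 : ∀ a n, iteratedDeriv n (T (a - 1)) a = F a n := fun a n => by
    rw [hTj]
    have : (a:ℝ) - ((a - 1 : ℤ) : ℝ) = 1 := by push_cast; ring
    rw [this, hG1, sub_add_cancel]
  let g : ℝ → ℝ := fun x => T ⌊x⌋ x
  let K : ℤ → ℝ → ℝ := fun a x => if (a:ℝ) ≤ x then T a x else T (a - 1) x
  have hK := fun a : ℤ => glue (hT (a-1)) (hT a) a (fun n => by rw [hT0, hT1])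
  have hgK : ∀ a : ℤ, ∀ x ∈ Set.Ioo ((a:ℝ) - 1) (a + 1), g x = K a x := by
    intro a x hx
    simp only [g, K]
    split_ifs with h
    · rw [Int.floor_eq_iff.2 ⟨h, hx.2⟩]
    · have : ⌊x⌋ = a - 1 := Int.floor_eq_iff.2 (by push_cast; exact ⟨hx.1.le, by linarith [not_le.1 h]⟩)
      rw [this]
  have hgE : ∀ a : ℤ, ∀ x ∈ Set.Ioo ((a:ℝ) - 1) (a + 1), g =ᶠ[nhds x] K a := by
    intro a x hx
    filter_upwards [Ioo_mem_nhds hx.1 hx.2] with y hy using hgK a y hy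
  have hfl : ∀ x : ℝ, x ∈ Set.Ioo ((⌊x⌋:ℝ) - 1) (⌊x⌋ + 1) := fun x =>
    ⟨by linarith [Int.floor_le x], Int.lt_floor_add_one x⟩
  have hsm : ContDiff ℝ ∞ g := contDiff_iff_contDiffAt.2 fun x =>
    (hK ⌊x⌋).1.contDiffAt.congr_of_eventuallyEq (hgE _ x (hfl x))
  have hj : ∀ a : ℤ, ∀ n : ℕ, iteratedDeriv n g a = F a n := by
    intro a n
    rw [(hgE a a ⟨by linarith, by linarith⟩).iteratedDeriv_eq]
    exact ((hK a).2 n).trans (hT0 a n)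
  have hv : ∀ a : ℤ, g a = F a 0 := fun a => by simpa using hj a 0
  refine ⟨g, hsm, ?_, ?_, hj⟩
  · intro y
    refine mem_range_of_exists_le_of_exists_ge hsm.continuous ?_ ?_
    · by_contra! hc
      exact hbelow ⟨y, by rintro _ ⟨a, rfl⟩; simpa [hv] using (hc a).le⟩
    · by_contra! hc
      exact habove ⟨y, by rintro _ ⟨a, rfl⟩; simpa [hv] using (hc a).le⟩
  · intro x
    rcases (Int.floor_le x).eq_or_lt with h | h
    · have := hj ⌊x⌋ 1
      rw [iteratedDeriv_one, h] at this
      rw [this]; exact hpos _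
    · have e : g =ᶠ[nhds x] T ⌊x⌋ := by
        filter_upwards [Ioo_mem_nhds h (Int.lt_floor_add_one x)] with y hy
        simp only [g]
        rw [Int.floor_eq_iff.2 ⟨hy.1.le, hy.2⟩]
      rw [e.deriv_eq, ← iteratedDeriv_one, hTj, iteratedDeriv_one]
      exact hGpos _ _ (by linarith) (by linarith [Int.lt_floor_add_one x])
end
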